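/- arXiv:0809.1828 — 3 statements merged into one kernel-verified Lean document; each statement's English description precedes it below -/
import Mathlib

section
/- Let P be a partial order on a finite type and M a module of P. If the partial order induced on M is diametrally reversing, then P is diametrally reversing. -/
/-- `L` is a linear extension of the partial order `P`. -/
def IsLinExt {α : Type*} (P : PartialOrder α) (L : LinearOrder α) : Prop :=
  ∀ x y : α, P.le x y → L.le x y

/-- The distance between two linear orders: the number of ordered pairs `(x, y)` with
`x < y` in `L₁` and `y < x` in `L₂`. -/
noncomputable def leDist {α : Type*} (L₁ L₂ : LinearOrder α) : ℕ :=
  Set.ncard {p : α × α | L₁.lt p.1 p.2 ∧ L₂.lt p.2 p.1}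

/-- `(L₁, L₂)` is a diametral pair of linear extensions of `P`. -/
def IsDiametralPair {α : Type*} (P : PartialOrder α) (L₁ L₂ : LinearOrder α) : Prop :=
  IsLinExt P L₁ ∧ IsLinExt P L₂ ∧
    ∀ M₁ M₂ : LinearOrder α, IsLinExt P M₁ → IsLinExt P M₂ →
      leDist M₁ M₂ ≤ leDist L₁ L₂

/-- A linear extension is diametral if it belongs to some diametral pair. -/
def IsDiametral {α : Type*} (P : PartialOrder α) (L : LinearOrder α) : Prop :=
  ∃ L' : LinearOrder α, IsDiametralPair P L L' ∨ IsDiametralPair P L' L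

/-- The linear extension diameter of `P`. -/
noncomputable def led {α : Type*} (P : PartialOrder α) : ℕ :=
  sSup {d : ℕ | ∃ L₁ L₂ : LinearOrder α, IsLinExt P L₁ ∧ IsLinExt P L₂ ∧ leDist L₁ L₂ = d}

/-- `(u, v)` is a critical pair of `P`. -/
def IsCriticalPair {α : Type*} (P : PartialOrder α) (u v : α) : Prop :=
  ¬ P.le u v ∧ ¬ P.le v u ∧ (∀ z, P.lt z u → P.lt z v) ∧ (∀ z, P.lt v z → P.lt u z)

/-- `L` reverses some critical pair of `P`. -/
def Reverses {α : Type*} (P : PartialOrder α) (L : LinearOrder α) : Prop :=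
  ∃ u v : α, IsCriticalPair P u v ∧ L.lt v u

/-- `P` is diametrally reversing: every diametral linear extension reverses a critical pair. -/
def DiametrallyReversing {α : Type*} (P : PartialOrder α) : Prop :=
  ∀ L : LinearOrder α, IsDiametral P L → Reverses P L

/-- `M` is a module of `P`. -/
def IsModuleOf {α : Type*} (P : PartialOrder α) (M : Set α) : Prop :=
  ∀ x, x ∉ M →
    (∀ m ∈ M, P.lt x m) ∨ (∀ m ∈ M, P.lt m x) ∨ (∀ m ∈ M, ¬ P.le x m ∧ ¬ P.le m x)

/-- `P` is a chain: any two elements are comparable. -/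
def IsChainOrder {α : Type*} (P : PartialOrder α) : Prop :=
  ∀ x y : α, P.le x y ∨ P.le y x

/-- The partial order induced on a subset `M`. -/
def inducedOrder {α : Type*} (P : PartialOrder α) (M : Set α) : PartialOrder M :=
  letI := P
  PartialOrder.lift (fun a : M => (a : α)) Subtype.val_injective

/-- The linear order induced on a subset `M`. -/
noncomputable def inducedLinearOrder {α : Type*} (L : LinearOrder α) (M : Set α) :
    LinearOrder M :=
  letI := L
  LinearOrder.lift' (fun a : M => (a : α)) Subtype.val_injective

theorem isLinExt_inducedLinearOrder {α : Type*} {P : PartialOrder α} {L : LinearOrder α}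
    (hL : IsLinExt P L) (M : Set α) :
    IsLinExt (inducedOrder P M) (inducedLinearOrder L M) :=
  fun x y hxy => hL x y hxy

theorem IsLinExt.lt {α : Type*} {P : PartialOrder α} {L : LinearOrder α}
    (hL : IsLinExt P L) {x y : α} (h : P.lt x y) : L.lt x y :=
  @lt_of_le_of_ne α L.toPartialOrder x y (hL x y (@le_of_lt α P.toPreorder x y h))
    (@ne_of_lt α P.toPreorder x y h)

/-- The image of an injective map `e` can be gathered at the position of one of its elements
`e m` in a linear order, and reordered internally by any given linear order. -/
theorem exists_linearOrder_gather {α β : Type*} (L : LinearOrder α) (N : LinearOrder β)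
    {e : β → α} (he : Function.Injective e) (m : β) :
    ∃ K : LinearOrder α,
      (∀ x y, K.lt (e x) (e y) ↔ N.lt x y) ∧
      (∀ x y, (¬ ∃ b, e b = y) →
        (K.lt (e x) y ↔ L.lt (e m) y) ∧ (K.lt y (e x) ↔ L.lt y (e m))) ∧
      (∀ x y, (¬ ∃ b, e b = x) → (¬ ∃ b, e b = y) → (K.lt x y ↔ L.lt x y)) := by
  let f : α → α ×ₗ WithBot β :=
    Function.extend e (fun b => toLex (e m, (b : WithBot β))) (fun x => toLex (x, ⊥))
  have f_in (b : β) : f (e b) = toLex (e m, (b : WithBot β)) := he.extend_apply _ _ b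
  have f_out (x : α) (hx : ¬ ∃ b, e b = x) : f x = toLex (x, ⊥) :=
    Function.extend_apply' _ _ x hx
  have hf : Function.Injective f := by
    intro x y hxy
    by_cases hx : ∃ b, e b = x <;> by_cases hy : ∃ b, e b = y
    · obtain ⟨a, rfl⟩ := hx
      obtain ⟨b, rfl⟩ := hy
      simpa [f_in, he.eq_iff] using hxy
    · obtain ⟨a, rfl⟩ := hx
      simp [f_in, f_out y hy] at hxy
    · obtain ⟨b, rfl⟩ := hy
      simp [f_in, f_out x hx] at hxy
    · simpa [f_out x hx, f_out y hy] using hxy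
  let r : α → α → Prop := fun x y => f x < f y
  obtain ⟨K, hK⟩ : ∃ K : LinearOrder α, ∀ x y, K.lt x y ↔ r x y :=
    ⟨LinearOrder.lift' f hf, fun _ _ => Iff.rfl⟩
  refine ⟨K, fun x y => ?_, fun x y hy => ⟨?_, ?_⟩, fun x y hx hy => ?_⟩
  · rw [hK]
    have : ¬ L.lt (e m) (e m) := @lt_irrefl α L.toPreorder _
    simp [r, f_in, Prod.Lex.toLex_lt_toLex, this]
  · rw [hK]
    simp [r, f_in, f_out y hy, Prod.Lex.toLex_lt_toLex]
  · rw [hK]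
    have : y ≠ e m := fun h => hy ⟨m, h.symm⟩
    simp [r, f_in, f_out y hy, Prod.Lex.toLex_lt_toLex, this]
  · rw [hK]
    simp [r, f_out x hx, f_out y hy, Prod.Lex.toLex_lt_toLex]

/-- A module can be gathered at the position of one of its elements `m` in a linear extension,
and reordered internally by any of its own linear extensions. -/
theorem exists_linExt_gather {α : Type*} {P : PartialOrder α} {M : Set α}
    (hM : IsModuleOf P M) {L : LinearOrder α} (hL : IsLinExt P L) {N : LinearOrder M}
    (hN : IsLinExt (inducedOrder P M) N) (m : M) :
    ∃ K : LinearOrder α, IsLinExt P K ∧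
      (∀ x y : M, K.lt x y ↔ N.lt x y) ∧
      (∀ x : M, ∀ y, y ∉ M → (K.lt x y ↔ L.lt m y) ∧ (K.lt y x ↔ L.lt y m)) ∧
      (∀ x y, x ∉ M → y ∉ M → (K.lt x y ↔ L.lt x y)) := by
  obtain ⟨K, hin, hcross, hout⟩ := exists_linearOrder_gather L N Subtype.val_injective m
  simp only [Subtype.exists, exists_prop, exists_eq_right] at hcross hout
  refine ⟨K, fun x y hxy => ?_, hin, hcross, hout⟩
  by_cases hne : x = y
  · subst hne
    exact K.le_refl x
  have hlt : P.lt x y := (P.lt_iff_le_not_ge x y).2 ⟨hxy, fun h => hne (P.le_antisymm x y hxy h)⟩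
  have hno : ¬ P.lt y x := fun h => ((P.lt_iff_le_not_ge y x).1 h).2 hxy
  apply @le_of_lt α K.toPreorder
  by_cases hx : x ∈ M <;> by_cases hy : y ∈ M
  · exact (hin ⟨x, hx⟩ ⟨y, hy⟩).2 (hN.lt (x := ⟨x, hx⟩) (y := ⟨y, hy⟩) hlt)
  · refine (hcross ⟨x, hx⟩ y hy).1.2 (hL.lt ?_)
    rcases hM y hy with h | h | h
    · exact absurd (h x hx) hno
    · exact h m m.2
    · exact absurd hxy (h x hx).2
  · refine (hcross ⟨y, hy⟩ x hx).2.2 (hL.lt ?_)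
    rcases hM x hx with h | h | h
    · exact h m m.2
    · exact absurd (h y hy) hno
    · exact absurd hxy (h y hy).1
  · exact (hout x y hx hy).2 (hL.lt hlt)

open Classical in
/-- The indicator of the pair `(x, y)` being reversed between `L₁` and `L₂`. -/
noncomputable def reversalIndicator {α : Type*} (L₁ L₂ : LinearOrder α) (x y : α) : ℕ :=
  if L₁.lt x y ∧ L₂.lt y x then 1 else 0

theorem reversalIndicator_congr {α : Type*} {K₁ K₂ L₁ L₂ : LinearOrder α} {x y x' y' : α}
    (h₁ : K₁.lt x y ↔ L₁.lt x' y') (h₂ : K₂.lt y x ↔ L₂.lt y' x') :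
    reversalIndicator K₁ K₂ x y = reversalIndicator L₁ L₂ x' y' := by
  unfold reversalIndicator
  by_cases h : L₁.lt x' y' ∧ L₂.lt y' x'
  · rw [if_pos h, if_pos ⟨h₁.2 h.1, h₂.2 h.2⟩]
  · rw [if_neg h, if_neg fun h' => h ⟨h₁.1 h'.1, h₂.1 h'.2⟩]

theorem leDist_eq_sum {α : Type*} [Fintype α] (L₁ L₂ : LinearOrder α) :
    leDist L₁ L₂ = ∑ x, ∑ y, reversalIndicator L₁ L₂ x y := by
  classical
  unfold reversalIndicator
  rw [leDist, ← Fintype.sum_prod_type', Finset.sum_boole, Set.ncard_eq_toFinset_card']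
  simp

open Classical in
/-- The distance splits into the part inside `M`, the pairs between `M` and its complement,
and the part outside `M`. -/
theorem leDist_eq_add {α : Type*} [Fintype α] (L₁ L₂ : LinearOrder α) (M : Set α) :
    leDist L₁ L₂ = leDist (inducedLinearOrder L₁ M) (inducedLinearOrder L₂ M) +
      (∑ x : M, ∑ y : {y // y ∉ M}, (reversalIndicator L₁ L₂ x y +
        reversalIndicator L₁ L₂ y x)) +
      ∑ x : {x // x ∉ M}, ∑ y : {y // y ∉ M}, reversalIndicator L₁ L₂ x y := by
  have split (f : α → ℕ) : ∑ x, f x = ∑ x : M, f x + ∑ x : {x // x ∉ M}, f x :=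
    (Fintype.sum_subtype_add_sum_subtype (· ∈ M) f).symm
  rw [leDist_eq_sum, leDist_eq_sum]
  simp only [split, Finset.sum_add_distrib]
  rw [Finset.sum_comm (s := (Finset.univ : Finset {x // x ∉ M})) (t := (Finset.univ : Finset M))]
  simp only [add_assoc]
  rfl

/-- A diametral pair restricts to a diametral pair on every module. -/
theorem IsDiametralPair.induced {α : Type*} [Fintype α] {P : PartialOrder α} {M : Set α}
    (hM : IsModuleOf P M) {L₁ L₂ : LinearOrder α} (h : IsDiametralPair P L₁ L₂) :
    IsDiametralPair (inducedOrder P M) (inducedLinearOrder L₁ M) (inducedLinearOrder L₂ M) := by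
  classical
  obtain ⟨h₁, h₂, hmax⟩ := h
  refine ⟨isLinExt_inducedLinearOrder h₁ M, isLinExt_inducedLinearOrder h₂ M,
    fun N₁ N₂ hN₁ hN₂ => ?_⟩
  rcases isEmpty_or_nonempty M with hE | hE
  · simp [leDist, Set.eq_empty_of_isEmpty]
  let c : M → ℕ := fun x => ∑ y : {y // y ∉ M}, (reversalIndicator L₁ L₂ x y +
    reversalIndicator L₁ L₂ y x)
  obtain ⟨m, hm⟩ := Finite.exists_max c
  obtain ⟨K₁, hK₁, hin₁, hcross₁, hout₁⟩ := exists_linExt_gather hM h₁ hN₁ m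
  obtain ⟨K₂, hK₂, hin₂, hcross₂, hout₂⟩ := exists_linExt_gather hM h₂ hN₂ m
  have hle := hmax K₁ K₂ hK₁ hK₂
  rw [leDist_eq_add K₁ K₂ M, leDist_eq_add L₁ L₂ M] at hle
  have hN : leDist (inducedLinearOrder K₁ M) (inducedLinearOrder K₂ M) = leDist N₁ N₂ := by
    unfold leDist
    congr 1
    ext p
    exact and_congr (hin₁ _ _) (hin₂ _ _)
  have hc : ∑ x : M, c x ≤ ∑ x : M, ∑ y : {y // y ∉ M},
      (reversalIndicator K₁ K₂ x y +
        reversalIndicator K₁ K₂ y x) := by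
    refine Finset.sum_le_sum fun x _ => (hm x).trans_eq <| Finset.sum_congr rfl fun y _ => ?_
    obtain ⟨h₁, h₁'⟩ := hcross₁ x y y.2
    obtain ⟨h₂, h₂'⟩ := hcross₂ x y y.2
    rw [reversalIndicator_congr h₁ h₂', reversalIndicator_congr h₁' h₂]
  have ho : (∑ x : {x // x ∉ M}, ∑ y : {y // y ∉ M},
      reversalIndicator K₁ K₂ x y) =
      ∑ x : {x // x ∉ M}, ∑ y : {y // y ∉ M}, reversalIndicator L₁ L₂ x y := by
    refine Finset.sum_congr rfl fun x _ => Finset.sum_congr rfl fun y _ => ?_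
    exact reversalIndicator_congr (hout₁ x y x.2 y.2) (hout₂ y x y.2 x.2)
  rw [hN, ho] at hle
  simp only [c] at hc
  omega

/-- A critical pair of a module is a critical pair of the whole order. -/
theorem IsCriticalPair.of_induced {α : Type*} {P : PartialOrder α} {M : Set α}
    (hM : IsModuleOf P M) {u v : M} (h : IsCriticalPair (inducedOrder P M) u v) :
    IsCriticalPair P u v := by
  let := P
  obtain ⟨huv, hvu, hdown, hup⟩ := h
  refine ⟨huv, hvu, fun z hz => ?_, fun z hz => ?_⟩
  · by_cases hzM : z ∈ M
    · exact hdown ⟨z, hzM⟩ hz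
    rcases hM z hzM with h | h | h
    · exact h v v.2
    · exact absurd (lt_trans hz (h u u.2)) (lt_irrefl z)
    · exact absurd (le_of_lt hz) (h u u.2).1
  · by_cases hzM : z ∈ M
    · exact hup ⟨z, hzM⟩ hz
    rcases hM z hzM with h | h | h
    · exact absurd (lt_trans hz (h v v.2)) (lt_irrefl (v : α))
    · exact h u u.2
    · exact absurd (le_of_lt hz) (h v v.2).2

/-- If a module `M` of `P` induces a diametrally reversing poset, then `P` is
diametrally reversing. -/
theorem statement_6 {α : Type*} [Fintype α] (P : PartialOrder α) (M : Set α)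
    (hM : IsModuleOf P M) (h : DiametrallyReversing (inducedOrder P M)) :
    DiametrallyReversing P := by
  rintro L ⟨L', hL⟩
  obtain ⟨u, v, huv, hlt⟩ := h (inducedLinearOrder L M)
    ⟨inducedLinearOrder L' M, hL.imp (·.induced hM) (·.induced hM)⟩
  exact ⟨u, v, huv.of_induced hM, hlt⟩
end

section
/- Every finite unit interval order that is not a chain is diametrally reversing. That is: let P be a partial order on a finite type that is not a chain, and suppose there exists ℓ : P → ℝ such that for all x, y: x < y in P if and only if ℓ(x) + 1 ≤ ℓ(y). Then P is diametrally reversing. -/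
theorem leDist_comm {α : Type*} (L₁ L₂ : LinearOrder α) : leDist L₁ L₂ = leDist L₂ L₁ := by
  unfold leDist
  rw [← Set.ncard_image_of_injective _ (Prod.swap_injective (α := α) (β := α))]
  congr 1
  ext ⟨a, b⟩
  simp [Set.image_swap_eq_preimage_swap, and_comm]

theorem IsDiametralPair.symm {α : Type*} {P : PartialOrder α} {L₁ L₂ : LinearOrder α}
    (h : IsDiametralPair P L₁ L₂) : IsDiametralPair P L₂ L₁ :=
  ⟨h.2.1, h.1, fun M₁ M₂ h₁ h₂ => leDist_comm L₁ L₂ ▸ h.2.2 M₁ M₂ h₁ h₂⟩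

theorem exists_linearOrder_lt_iff {α β : Type*} [LinearOrder β] (g : α → β)
    (hg : Function.Injective g) : ∃ M : LinearOrder α, ∀ a b, M.lt a b ↔ g a < g b :=
  ⟨LinearOrder.lift' g hg, fun _ _ => Iff.rfl⟩

/-- Two elements with consecutive values under `f` can be exchanged without changing the relative
order of any other pair. -/
theorem exists_perm_lt_of_consecutive {α β : Type*} [LinearOrder β] {f : α → β}
    (hf : Function.Injective f) {u v : α} (huv : f u < f v)
    (hcons : ∀ w, f u < f w → f v ≤ f w) :
    ∃ σ : Equiv.Perm α, f (σ v) < f (σ u) ∧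
      ∀ a b, f a < f b → ¬ (a = u ∧ b = v) → f (σ a) < f (σ b) := by
  classical
  refine ⟨Equiv.swap u v, by simpa using huv, fun a b hab hp => ?_⟩
  have hlast (w : α) (hw : f w < f v) : f w ≤ f u := by
    by_contra! h
    exact absurd (hcons w h) hw.not_ge
  have hfne (x y : α) (h : x ≠ y) : f x ≠ f y := hf.ne h
  rw [Equiv.swap_apply_def, Equiv.swap_apply_def]
  grind

section UnitInterval

variable {α : Type*} {P : PartialOrder α} {f : α → ℝ}

theorem le_iff_eq_or_add_one_le (hrep : ∀ x y : α, P.lt x y ↔ f x + 1 ≤ f y) (x y : α) :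
    P.le x y ↔ x = y ∨ f x + 1 ≤ f y := by
  rw [← hrep]
  exact le_iff_eq_or_lt

/-- In a unit interval order, an incomparable pair listed by left endpoint is critical. -/
theorem isCriticalPair_of_le (hrep : ∀ x y : α, P.lt x y ↔ f x + 1 ≤ f y) {x y : α}
    (hne : x ≠ y) (hle : f x ≤ f y) (hlt : f y < f x + 1) : IsCriticalPair P x y := by
  refine ⟨?_, ?_, fun z => ?_, fun z => ?_⟩
  · rw [le_iff_eq_or_add_one_le hrep]
    rintro (h | h)
    · exact hne h
    · linarith
  · rw [le_iff_eq_or_add_one_le hrep]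
    rintro (h | h)
    · exact hne h.symm
    · linarith
  · rw [hrep, hrep]
    intro h
    linarith
  · rw [hrep, hrep]
    intro h
    linarith

/-- A linear extension reversing no critical pair lists the elements by left endpoint. -/
theorem lt_of_not_reverses (hrep : ∀ x y : α, P.lt x y ↔ f x + 1 ≤ f y) {L : LinearOrder α}
    (hL : IsLinExt P L) (hrev : ¬ Reverses P L) {x y : α} (hne : x ≠ y) (hle : f x ≤ f y) :
    L.lt x y := by
  by_cases h : f x + 1 ≤ f y
  · exact @lt_of_le_of_ne α L.toPartialOrder _ _ (hL x y ((le_iff_eq_or_add_one_le hrep x y).2 (Or.inr h))) hne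
  · rcases @lt_or_gt_of_ne α L _ _ hne with hxy | hyx
    · exact hxy
    · exact absurd ⟨x, y, isCriticalPair_of_le hrep hne hle (not_le.1 h), hyx⟩ hrev

theorem injective_of_not_reverses (hrep : ∀ x y : α, P.lt x y ↔ f x + 1 ≤ f y)
    {L : LinearOrder α} (hL : IsLinExt P L) (hrev : ¬ Reverses P L) : Function.Injective f := by
  intro x y hxy
  by_contra hne
  exact @lt_asymm α L.toPreorder _ _ (lt_of_not_reverses hrep hL hrev hne hxy.le)
    (lt_of_not_reverses hrep hL hrev (Ne.symm hne) hxy.ge)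

theorem lt_iff_of_not_reverses (hrep : ∀ x y : α, P.lt x y ↔ f x + 1 ≤ f y)
    {L : LinearOrder α} (hL : IsLinExt P L) (hrev : ¬ Reverses P L) (x y : α) :
    L.lt x y ↔ f x < f y := by
  constructor
  · intro h
    by_contra! hle
    exact @lt_asymm α L.toPreorder _ _ h
      (lt_of_not_reverses hrep hL hrev (@ne_of_gt α L.toPreorder _ _ h) hle)
  · intro h
    exact lt_of_not_reverses hrep hL hrev (fun he => h.ne (congrArg f he)) h.le

/-- If `L` lists the elements by left endpoint and belongs to a diametral pair, then the other
member reverses each incomparable pair which is consecutive in `L`: otherwise swapping this pair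
in `L` would increase the distance. -/
theorem IsDiametralPair.lt_of_consecutive [Finite α]
    (hrep : ∀ x y : α, P.lt x y ↔ f x + 1 ≤ f y) {L L' : LinearOrder α}
    (hd : IsDiametralPair P L L') (hf : Function.Injective f)
    (hLf : ∀ x y, L.lt x y ↔ f x < f y) {u v : α} (huv : f u < f v) (hinc : f v < f u + 1)
    (hcons : ∀ w, f u < f w → f v ≤ f w) : L'.lt v u := by
  by_contra hnot
  have hne : u ≠ v := fun h => huv.ne (congrArg f h)
  have hL' : L'.lt u v := @lt_of_le_of_ne α L'.toPartialOrder _ _ ((@not_lt α L' _ _).1 hnot) hne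
  obtain ⟨σ, hσ, hσ'⟩ := exists_perm_lt_of_consecutive hf huv hcons
  obtain ⟨M, hMlt⟩ := exists_linearOrder_lt_iff (fun a => f (σ a)) (hf.comp σ.injective)
  have hkeep (a b : α) (hab : f a < f b) (hp : ¬ (a = u ∧ b = v)) : M.lt a b :=
    (hMlt a b).2 (hσ' a b hab hp)
  have hM : IsLinExt P M := by
    intro a b hab
    rcases (le_iff_eq_or_add_one_le hrep a b).1 hab with rfl | h
    · exact M.le_refl a
    · refine @le_of_lt α M.toPreorder _ _ (hkeep a b (by linarith) ?_)
      rintro ⟨rfl, rfl⟩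
      linarith
  refine absurd (hd.2.2 M L' hM hd.2.1) (not_le.2 ?_)
  refine Set.ncard_lt_ncard ((Set.ssubset_iff_of_subset ?_).2 ⟨(v, u), ?_, ?_⟩) (Set.toFinite _)
  · rintro ⟨a, b⟩ ⟨hab, hba⟩
    refine ⟨hkeep a b ((hLf a b).1 hab) ?_, hba⟩
    rintro ⟨rfl, rfl⟩
    exact hnot hba
  · exact ⟨(hMlt v u).2 hσ, hL'⟩
  · rintro ⟨h, -⟩
    exact lt_asymm huv ((hLf v u).1 h)

theorem IsDiametralPair.lt_of_incomparable [Finite α]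
    (hrep : ∀ x y : α, P.lt x y ↔ f x + 1 ≤ f y) {L L' : LinearOrder α}
    (hd : IsDiametralPair P L L') (hf : Function.Injective f)
    (hLf : ∀ x y, L.lt x y ↔ f x < f y) {u v : α} (huv : f u < f v) (hinc : f v < f u + 1) :
    L'.lt v u := by
  by_contra hnot
  obtain ⟨⟨a, b⟩, ⟨hab, hinc', hnot'⟩, hmin⟩ := Set.exists_min_image
    {p : α × α | f p.1 < f p.2 ∧ f p.2 < f p.1 + 1 ∧ ¬ L'.lt p.2 p.1}
    (fun p => f p.2 - f p.1) (Set.toFinite _) ⟨(u, v), huv, hinc, hnot⟩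
  dsimp only at hab hinc' hnot' hmin
  refine hnot' (hd.lt_of_consecutive hrep hf hLf hab hinc' fun w hw => ?_)
  by_contra! hwb
  have haw : L'.lt w a := by
    by_contra h
    have := hmin (a, w) ⟨hw, by dsimp only; linarith, h⟩
    dsimp only at this
    linarith
  have hbw : L'.lt b w := by
    by_contra h
    have := hmin (w, b) ⟨hwb, by dsimp only; linarith, h⟩
    dsimp only at this
    linarith
  exact hnot' (@lt_trans α L'.toPreorder _ _ _ hbw haw)

end UnitInterval

/-- Every finite unit interval order which is not a chain is diametrally reversing. -/
theorem statement_10 {α : Type*} [Fintype α] (P : PartialOrder α)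
    (hchain : ¬ IsChainOrder P) (f : α → ℝ)
    (hrep : ∀ x y : α, P.lt x y ↔ f x + 1 ≤ f y) :
    DiametrallyReversing P := by
  rintro L ⟨L', hL'⟩
  have hd : IsDiametralPair P L L' := hL'.elim id IsDiametralPair.symm
  by_contra hrev
  have hf := injective_of_not_reverses hrep hd.1 hrev
  have hLf := lt_iff_of_not_reverses hrep hd.1 hrev
  have hext (x y : α) (h : f x + 1 ≤ f y) : L'.le x y :=
    hd.2.1 x y ((le_iff_eq_or_add_one_le hrep x y).2 (Or.inr h))
  have hopp {u v : α} (huv : f u < f v) (hinc : f v < f u + 1) : L'.lt v u :=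
    hd.lt_of_incomparable hrep hf hLf huv hinc
  obtain ⟨x, y, hne, hxy, hinc⟩ : ∃ x y, x ≠ y ∧ f x < f y ∧ f y < f x + 1 := by
    simp only [IsChainOrder, le_iff_eq_or_add_one_le hrep] at hchain
    push Not at hchain
    obtain ⟨x, y, ⟨hne, h₁⟩, -, h₂⟩ := hchain
    rcases lt_or_gt_of_ne (hf.ne hne) with h | h
    · exact ⟨x, y, hne, h, h₁⟩
    · exact ⟨y, x, hne.symm, h, h₂⟩
  have hcrit := isCriticalPair_of_le hrep hne hxy.le hinc
  refine hrev ⟨y, x, ⟨hcrit.2.1, hcrit.1, fun z hz => ?_, fun z hz => ?_⟩, (hLf x y).2 hxy⟩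
  · rw [hrep] at hz ⊢
    by_contra! h
    exact @not_le_of_gt α L'.toPreorder _ _
      (@lt_trans α L'.toPreorder _ _ _ (hopp hxy hinc) (hopp (by linarith) h)) (hext z y hz)
  · rw [hrep] at hz ⊢
    by_contra! h
    exact @not_le_of_gt α L'.toPreorder _ _
      (@lt_trans α L'.toPreorder _ _ _ (hopp (by linarith) h) (hopp hxy hinc)) (hext x z hz)
end

section
/- Let P be a partial order on a finite type admitting a realiser of size 2, i.e., two linear extensions M₁, M₂ such that for all x, y: x ≤ y in P if and only if x ≤ y in M₁ and x ≤ y in M₂. Then a pair (L₁, L₂) of linear extensions of P is a diametral pair if and only if {L₁, L₂} is a realiser of P, i.e., for all x, y: x ≤ y in P if and only if x ≤ y in L₁ and x ≤ y in L₂. -/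
/-- The ordered pairs of elements that are ordered differently by `L₁` and `L₂`. -/
def reversedPairs {α : Type*} (L₁ L₂ : LinearOrder α) : Set (α × α) :=
  {p | (L₁.lt p.1 p.2 ∧ L₂.lt p.2 p.1) ∨ (L₁.lt p.2 p.1 ∧ L₂.lt p.1 p.2)}

/-- The ordered pairs of incomparable elements of `P`. -/
def incomparablePairs {α : Type*} (P : PartialOrder α) : Set (α × α) :=
  {p | ¬ P.le p.1 p.2 ∧ ¬ P.le p.2 p.1}

theorem ncard_reversedPairs {α : Type*} [Finite α] (L₁ L₂ : LinearOrder α) :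
    (reversedPairs L₁ L₂).ncard = 2 * leDist L₁ L₂ := by
  have hunion : reversedPairs L₁ L₂ = {p : α × α | L₁.lt p.1 p.2 ∧ L₂.lt p.2 p.1} ∪
      Prod.swap '' {p : α × α | L₁.lt p.1 p.2 ∧ L₂.lt p.2 p.1} := by
    rw [Set.image_swap_eq_preimage_swap]
    rfl
  have hdisj : Disjoint {p : α × α | L₁.lt p.1 p.2 ∧ L₂.lt p.2 p.1}
      (Prod.swap '' {p : α × α | L₁.lt p.1 p.2 ∧ L₂.lt p.2 p.1}) := by
    rw [Set.image_swap_eq_preimage_swap, Set.disjoint_left]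
    intro p hp hq
    exact (@lt_asymm α L₁.toPreorder _ _ hp.1) hq.1
  rw [hunion, Set.ncard_union_eq hdisj (Set.toFinite _) (Set.toFinite _),
    Set.ncard_image_of_injective _ Prod.swap_injective, two_mul]
  rfl

theorem reversedPairs_subset_incomparablePairs {α : Type*} {P : PartialOrder α}
    {L₁ L₂ : LinearOrder α} (hL₁ : IsLinExt P L₁) (hL₂ : IsLinExt P L₂) :
    reversedPairs L₁ L₂ ⊆ incomparablePairs P := by
  rintro p (⟨h, hrev⟩ | ⟨h, hrev⟩)
  · exact ⟨fun hp => @not_le_of_gt α L₂.toPreorder _ _ hrev (hL₂ _ _ hp),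
      fun hp => @not_le_of_gt α L₁.toPreorder _ _ h (hL₁ _ _ hp)⟩
  · exact ⟨fun hp => @not_le_of_gt α L₁.toPreorder _ _ h (hL₁ _ _ hp),
      fun hp => @not_le_of_gt α L₂.toPreorder _ _ hrev (hL₂ _ _ hp)⟩

/-- Two linear extensions form a realiser exactly when they reverse every incomparable pair. -/
theorem realiser_iff_reversedPairs_eq {α : Type*} {P : PartialOrder α}
    {L₁ L₂ : LinearOrder α} (hL₁ : IsLinExt P L₁) (hL₂ : IsLinExt P L₂) :
    (∀ x y : α, P.le x y ↔ (L₁.le x y ∧ L₂.le x y)) ↔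
      reversedPairs L₁ L₂ = incomparablePairs P := by
  constructor
  · refine fun h => (reversedPairs_subset_incomparablePairs hL₁ hL₂).antisymm ?_
    rintro ⟨x, y⟩ ⟨hxy, hyx⟩
    rw [h] at hxy hyx
    rcases @lt_trichotomy α L₁ x y with h1 | rfl | h1
    · exact Or.inl ⟨h1, (@not_le α L₂ _ _).1
        fun h2 => hxy ⟨@le_of_lt α L₁.toPreorder _ _ h1, h2⟩⟩
    · exact absurd ⟨L₁.le_refl x, L₂.le_refl x⟩ hxy
    · exact Or.inr ⟨h1, (@not_le α L₂ _ _).1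
        fun h2 => hyx ⟨@le_of_lt α L₁.toPreorder _ _ h1, h2⟩⟩
  · refine fun h x y => ⟨fun hxy => ⟨hL₁ x y hxy, hL₂ x y hxy⟩, fun ⟨h1, h2⟩ => ?_⟩
    by_contra hxy
    by_cases hyx : P.le y x
    · exact hxy (L₁.le_antisymm x y h1 (hL₁ y x hyx) ▸ P.le_refl x)
    · have hmem : (x, y) ∈ reversedPairs L₁ L₂ := h ▸ ⟨hxy, hyx⟩
      rcases hmem with ⟨-, hrev⟩ | ⟨hrev, -⟩
      · exact @not_le_of_gt α L₂.toPreorder _ _ hrev h2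
      · exact @not_le_of_gt α L₁.toPreorder _ _ hrev h1

/-- If `P` has a realiser of size 2, then a pair of linear extensions of `P` is a
diametral pair if and only if it is a realiser of `P`. -/
theorem statement_16 {α : Type*} [Fintype α] (P : PartialOrder α)
    (M₁ M₂ : LinearOrder α) (h₁ : IsLinExt P M₁) (h₂ : IsLinExt P M₂)
    (hreal : ∀ x y : α, P.le x y ↔ (M₁.le x y ∧ M₂.le x y))
    (L₁ L₂ : LinearOrder α) (hL₁ : IsLinExt P L₁) (hL₂ : IsLinExt P L₂) :
    IsDiametralPair P L₁ L₂ ↔ (∀ x y : α, P.le x y ↔ (L₁.le x y ∧ L₂.le x y)) := by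
  rw [realiser_iff_reversedPairs_eq hL₁ hL₂]
  rw [realiser_iff_reversedPairs_eq h₁ h₂] at hreal
  constructor
  · rintro ⟨-, -, hmax⟩
    refine Set.eq_of_subset_of_ncard_le (reversedPairs_subset_incomparablePairs hL₁ hL₂) ?_
      (Set.toFinite _)
    rw [← hreal, ncard_reversedPairs, ncard_reversedPairs]
    exact Nat.mul_le_mul_left 2 (hmax M₁ M₂ h₁ h₂)
  · refine fun h => ⟨hL₁, hL₂, fun N₁ N₂ hN₁ hN₂ => ?_⟩
    have hle := Set.ncard_le_ncard (reversedPairs_subset_incomparablePairs hN₁ hN₂)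
      (Set.toFinite _)
    rw [← h, ncard_reversedPairs, ncard_reversedPairs] at hle
    lia
end
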